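/- Let Z be a Gaussian random variable with mean μ and variance σ² > 0. Then for every real x with |x| ≤ 1, P(Z ≥ μ + x·σ) ≥ (1/(4√π)) · exp(−x²). In particular, taking |x| ≤ 1 yields P(Z ≥ μ + x·σ) ≥ 1/(4e√π). -/

import Mathlib

open MeasureTheory ProbabilityTheory
open scoped NNReal

/-- The Gaussian density with mean `-x√v` dominates, up to the factor `exp (-x²)`, a centred
Gaussian function of half the variance. -/
lemma exp_neg_sq_mul_exp_le_gaussianPDFReal (v : ℝ≥0) (hv : v ≠ 0) (x s : ℝ) :
    (Real.sqrt (2 * Real.pi * v))⁻¹ * Real.exp (-x ^ 2) * Real.exp (-(v : ℝ)⁻¹ * s ^ 2)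
      ≤ gaussianPDFReal (-(x * Real.sqrt v)) v s := by
  have hv' : (0 : ℝ) < v := by positivity
  have hσ : Real.sqrt v ^ 2 = (v : ℝ) := Real.sq_sqrt hv'.le
  rw [gaussianPDFReal, mul_assoc (Real.sqrt _)⁻¹, ← Real.exp_add]
  gcongr
  have h : (s - -(x * Real.sqrt v)) ^ 2 / (2 * v) ≤ x ^ 2 + (v : ℝ)⁻¹ * s ^ 2 := by
    rw [div_le_iff₀ (by positivity)]
    have e : (x ^ 2 + (v : ℝ)⁻¹ * s ^ 2) * (2 * v) = 2 * (x * Real.sqrt v) ^ 2 + 2 * s ^ 2 := by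
      rw [mul_pow, hσ]
      field_simp
    rw [e]
    nlinarith [sq_nonneg (s - x * Real.sqrt v)]
  rw [neg_div]
  linarith

/-- Lower bound on the upper tail of a Gaussian, valid at every real number of standard deviations
from the mean. -/
lemma exp_neg_sq_div_le_gaussianReal_upper_tail (μ : ℝ) (v : ℝ≥0) (hv : v ≠ 0) (x : ℝ) :
    Real.exp (-x ^ 2) / (2 * Real.sqrt 2)
      ≤ ((gaussianReal μ v) {z | μ + x * Real.sqrt (v : ℝ) ≤ z}).toReal := by
  have hv' : (0 : ℝ) < v := by positivity
  have hshift : (gaussianReal μ v) {z | μ + x * Real.sqrt (v : ℝ) ≤ z}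
      = gaussianReal (-(x * Real.sqrt v)) v (Set.Ici 0) := by
    have h := gaussianReal_map_sub_const (μ := μ) (v := v) (μ + x * Real.sqrt v)
    rw [show μ - (μ + x * Real.sqrt v) = -(x * Real.sqrt v) by ring] at h
    rw [← h, Measure.map_apply (by fun_prop) measurableSet_Ici]
    congr 1
    ext z
    simp
  rw [hshift, gaussianReal_apply_eq_integral _ hv, ENNReal.toReal_ofReal
    (integral_nonneg fun s ↦ gaussianPDFReal_nonneg _ _ s), integral_Ici_eq_integral_Ioi]
  calc Real.exp (-x ^ 2) / (2 * Real.sqrt 2)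
      = ∫ s in Set.Ioi (0 : ℝ), (Real.sqrt (2 * Real.pi * v))⁻¹ * Real.exp (-x ^ 2)
          * Real.exp (-(v : ℝ)⁻¹ * s ^ 2) := by
        rw [integral_const_mul, integral_gaussian_Ioi, div_inv_eq_mul,
          mul_assoc 2, Real.sqrt_mul zero_le_two]
        have : Real.sqrt (Real.pi * v) ≠ 0 := by positivity
        field_simp
    _ ≤ _ := integral_mono
        (((integrable_exp_neg_mul_sq (inv_pos.2 hv')).const_mul _).integrableOn)
        (integrable_gaussianPDFReal _ _).integrableOn
        fun s ↦ exp_neg_sq_mul_exp_le_gaussianPDFReal v hv x s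

/-- Gaussian anti-concentration: if `Z ~ N(μ, v)` with standard deviation `σ = √v > 0`,
then for every `x` with `|x| ≤ 1`, `P(Z ≥ μ + x·σ) ≥ (1/(4√π))·exp(−x²)`; in particular
`P(Z ≥ μ + x·σ) ≥ 1/(4e√π)`. -/
theorem gaussian_anticoncentration (μ : ℝ) (v : ℝ≥0) (hv : v ≠ 0) (x : ℝ) (hx : |x| ≤ 1) :
    (1 / (4 * Real.sqrt Real.pi)) * Real.exp (-x ^ 2)
        ≤ ((gaussianReal μ v) {z | μ + x * Real.sqrt (v : ℝ) ≤ z}).toReal ∧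
      1 / (4 * Real.exp 1 * Real.sqrt Real.pi)
        ≤ ((gaussianReal μ v) {z | μ + x * Real.sqrt (v : ℝ) ≤ z}).toReal := by
  have hmain : (1 / (4 * Real.sqrt Real.pi)) * Real.exp (-x ^ 2)
      ≤ ((gaussianReal μ v) {z | μ + x * Real.sqrt (v : ℝ) ≤ z}).toReal := by
    refine le_trans ?_ (exp_neg_sq_div_le_gaussianReal_upper_tail μ v hv x)
    rw [one_div_mul_eq_div]
    have : Real.sqrt 2 ≤ Real.sqrt Real.pi := Real.sqrt_le_sqrt Real.two_le_pi
    gcongr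
    norm_num
  refine ⟨hmain, le_trans ?_ hmain⟩
  have hexp : (Real.exp 1)⁻¹ ≤ Real.exp (-x ^ 2) := by
    rw [← Real.exp_neg]
    gcongr
    exact (sq_le_one_iff_abs_le_one x).2 hx
  calc 1 / (4 * Real.exp 1 * Real.sqrt Real.pi)
      = 1 / (4 * Real.sqrt Real.pi) * (Real.exp 1)⁻¹ := by field_simp
    _ ≤ _ := by gcongr
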